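/- Let T > 0 and let u : [0,T] × (0,1) → ℝ be continuously differentiable in t and twice continuously differentiable in r. For each t define the radial ansatz map U(t,x) = ((x₁/r)·sin(u(t,r)), (x₂/r)·sin(u(t,r)), cos(u(t,r))), r = |x|, for 0 < |x| < 1. Then U satisfies the harmonic map heat flow equation ∂ₜU(t,x) = ΔU(t,x) + (‖∂₁U(t,x)‖² + ‖∂₂U(t,x)‖²)·U(t,x) for all t ∈ [0,T] and all x with 0 < |x| < 1 if and only if u satisfies the radially symmetric equation ∂ₜu(t,r) = ∂ᵣᵣu(t,r) + (1/r)·∂ᵣu(t,r) − sin(2·u(t,r))/(2r²) for all (t,r) ∈ [0,T] × (0,1). -/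

import Mathlib

noncomputable section

/-- Partial derivative of `U` in the `i`-th coordinate direction. -/
def pderiv2 (i : Fin 2) (U : EuclideanSpace ℝ (Fin 2) → EuclideanSpace ℝ (Fin 3))
    (x : EuclideanSpace ℝ (Fin 2)) : EuclideanSpace ℝ (Fin 3) :=
  fderiv ℝ U x (EuclideanSpace.single i 1)

/-- Componentwise Laplacian `ΔU = ∂₁₁U + ∂₂₂U`. -/
def lap2 (U : EuclideanSpace ℝ (Fin 2) → EuclideanSpace ℝ (Fin 3))
    (x : EuclideanSpace ℝ (Fin 2)) : EuclideanSpace ℝ (Fin 3) :=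
  pderiv2 0 (pderiv2 0 U) x + pderiv2 1 (pderiv2 1 U) x

/-- The radial ansatz map `U(x) = ((x₁/r) sin u(r), (x₂/r) sin u(r), cos u(r))`, `r = |x|`. -/
def ansatz (u : ℝ → ℝ) (x : EuclideanSpace ℝ (Fin 2)) : EuclideanSpace ℝ (Fin 3) :=
  (WithLp.equiv 2 (Fin 3 → ℝ)).symm
    ![x 0 / ‖x‖ * Real.sin (u ‖x‖), x 1 / ‖x‖ * Real.sin (u ‖x‖), Real.cos (u ‖x‖)]

theorem HasDerivAt.hasFDerivAt_comp_norm {φ : ℝ → ℝ} {φ' : ℝ} {x : EuclideanSpace ℝ (Fin 2)}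
    (hx : 0 < ‖x‖) (h : HasDerivAt φ φ' ‖x‖) :
    HasFDerivAt (fun y : EuclideanSpace ℝ (Fin 2) => φ ‖y‖) ((φ' / ‖x‖) • innerSL ℝ x) x := by
  have h1 : HasFDerivAt (fun y : EuclideanSpace ℝ (Fin 2) => ‖y‖)
      ((1 / ‖x‖) • innerSL ℝ x) x := by
    have := ((hasStrictFDerivAt_norm_sq x).hasFDerivAt).sqrt (by positivity)
    simp only [Real.sqrt_sq (norm_nonneg _)] at this
    refine this.congr_fderiv ?_
    ext v
    simp
    field_simp
  refine (h.comp_hasFDerivAt x h1).congr_fderiv ?_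
  ext v
  simp
  ring

theorem pderiv2_eq_of_hasFDerivAt (i : Fin 2)
    {U : EuclideanSpace ℝ (Fin 2) → EuclideanSpace ℝ (Fin 3)}
    {x : EuclideanSpace ℝ (Fin 2)} {L₀ L₁ L₂ : EuclideanSpace ℝ (Fin 2) →L[ℝ] ℝ}
    (h₀ : HasFDerivAt (fun y => U y 0) L₀ x) (h₁ : HasFDerivAt (fun y => U y 1) L₁ x)
    (h₂ : HasFDerivAt (fun y => U y 2) L₂ x) :
    pderiv2 i U x = !₂[L₀ (EuclideanSpace.single i 1), L₁ (EuclideanSpace.single i 1),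
      L₂ (EuclideanSpace.single i 1)] := by
  have hU : DifferentiableAt ℝ U x := by
    rw [differentiableAt_euclidean]
    intro j
    fin_cases j
    exacts [h₀.differentiableAt, h₁.differentiableAt, h₂.differentiableAt]
  have hc : ∀ j, HasFDerivAt (fun y => U y j)
      ((EuclideanSpace.proj j : EuclideanSpace ℝ (Fin 3) →L[ℝ] ℝ).comp (fderiv ℝ U x)) x :=
    fun j => (EuclideanSpace.proj j : EuclideanSpace ℝ (Fin 3) →L[ℝ] ℝ).hasFDerivAt.comp x
      hU.hasFDerivAt
  ext j
  fin_cases j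
  · rw [h₀.unique (hc 0)]; rfl
  · rw [h₁.unique (hc 1)]; rfl
  · rw [h₂.unique (hc 2)]; rfl

theorem hasFDerivAt_coord (i : Fin 2) (x : EuclideanSpace ℝ (Fin 2)) :
    HasFDerivAt (fun y : EuclideanSpace ℝ (Fin 2) => y i)
      (EuclideanSpace.proj i : EuclideanSpace ℝ (Fin 2) →L[ℝ] ℝ) x :=
  (EuclideanSpace.proj i : EuclideanSpace ℝ (Fin 2) →L[ℝ] ℝ).hasFDerivAt

/-- The `i`-th partial derivative of the ansatz map, with `v` in the role of the derivative of
the profile `u`. -/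
def ansatzPartial (u v : ℝ → ℝ) (i : Fin 2) (x : EuclideanSpace ℝ (Fin 2)) :
    EuclideanSpace ℝ (Fin 3) :=
  !₂[EuclideanSpace.single (𝕜 := ℝ) i 1 0 * (Real.sin (u ‖x‖) / ‖x‖) + x 0 * x i *
      (v ‖x‖ * Real.cos (u ‖x‖) / ‖x‖ ^ 2 - Real.sin (u ‖x‖) / ‖x‖ ^ 3),
    EuclideanSpace.single (𝕜 := ℝ) i 1 1 * (Real.sin (u ‖x‖) / ‖x‖) + x 1 * x i *
      (v ‖x‖ * Real.cos (u ‖x‖) / ‖x‖ ^ 2 - Real.sin (u ‖x‖) / ‖x‖ ^ 3),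
    x i * (-(Real.sin (u ‖x‖) * v ‖x‖) / ‖x‖)]

theorem pderiv2_ansatz {u v : ℝ → ℝ} {x : EuclideanSpace ℝ (Fin 2)} (hx : 0 < ‖x‖)
    (hu : HasDerivAt u (v ‖x‖) ‖x‖) (i : Fin 2) :
    pderiv2 i (ansatz u) x = ansatzPartial u v i x := by
  have hg := (hu.sin.div (hasDerivAt_id ‖x‖) hx.ne').hasFDerivAt_comp_norm hx
  have hm := hu.cos.hasFDerivAt_comp_norm hx
  have hcomp (j : Fin 2) := (hasFDerivAt_coord j x).mul hg
  rw [pderiv2_eq_of_hasFDerivAt i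
    ((hcomp 0).congr_of_eventuallyEq (.of_forall fun y => ?_))
    ((hcomp 1).congr_of_eventuallyEq (.of_forall fun y => ?_))
    (hm.congr_of_eventuallyEq (.of_forall fun y => ?_))]
  · ext j
    fin_cases j <;>
      simp [ansatzPartial, EuclideanSpace.inner_single_right, -PiLp.single_apply] <;>
      field_simp <;> ring
  all_goals simp [ansatz]
  all_goals ring

theorem pderiv2_ansatzPartial {u v : ℝ → ℝ} {c : ℝ} {x : EuclideanSpace ℝ (Fin 2)} (hx : 0 < ‖x‖)
    (hu : HasDerivAt u (v ‖x‖) ‖x‖) (hv : HasDerivAt v c ‖x‖) (i : Fin 2) :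
    pderiv2 i (ansatzPartial u v i) x =
      let S := Real.sin (u ‖x‖)
      let C := Real.cos (u ‖x‖)
      let b := v ‖x‖
      let k := b * C / ‖x‖ ^ 2 - S / ‖x‖ ^ 3
      let k' := c * C / ‖x‖ ^ 2 - b ^ 2 * S / ‖x‖ ^ 2 - 3 * b * C / ‖x‖ ^ 3 + 3 * S / ‖x‖ ^ 4
      !₂[2 * (EuclideanSpace.single (𝕜 := ℝ) i 1 0) * x i * k + x 0 * k + x 0 * x i ^ 2 * k' / ‖x‖,
        2 * (EuclideanSpace.single (𝕜 := ℝ) i 1 1) * x i * k + x 1 * k + x 1 * x i ^ 2 * k' / ‖x‖,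
        -(S * b) / ‖x‖ + x i ^ 2 * (-(C * b ^ 2 + S * c) / ‖x‖ ^ 2 + S * b / ‖x‖ ^ 3)] := by
  have hid := hasDerivAt_id ‖x‖
  have hg := (hu.sin.div hid hx.ne').hasFDerivAt_comp_norm hx
  have hk := (((hv.mul hu.cos).div (hid.pow 2) (pow_ne_zero 2 hx.ne')).sub
    (hu.sin.div (hid.pow 3) (pow_ne_zero 3 hx.ne'))).hasFDerivAt_comp_norm hx
  have hm := ((hu.sin.mul hv).neg.div hid hx.ne').hasFDerivAt_comp_norm hx
  have hcomp (j : Fin 2) := (hg.const_mul (EuclideanSpace.single (𝕜 := ℝ) i 1 j)).add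
    (((hasFDerivAt_coord j x).mul (hasFDerivAt_coord i x)).mul hk)
  rw [pderiv2_eq_of_hasFDerivAt i
    ((hcomp 0).congr_of_eventuallyEq (.of_forall fun y => ?_))
    ((hcomp 1).congr_of_eventuallyEq (.of_forall fun y => ?_))
    (((hasFDerivAt_coord i x).mul hm).congr_of_eventuallyEq (.of_forall fun y => ?_))]
  · ext j
    fin_cases j <;>
      simp [EuclideanSpace.inner_single_right, -PiLp.single_apply] <;>
      field_simp <;> ring
  all_goals simp [ansatzPartial, -PiLp.single_apply]

theorem norm_ansatzPartial_sq_add {u v : ℝ → ℝ} {x : EuclideanSpace ℝ (Fin 2)} (hx : 0 < ‖x‖) :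
    ‖ansatzPartial u v 0 x‖ ^ 2 + ‖ansatzPartial u v 1 x‖ ^ 2 =
      v ‖x‖ ^ 2 + Real.sin (u ‖x‖) ^ 2 / ‖x‖ ^ 2 := by
  have hr : ‖x‖ ^ 2 = x 0 ^ 2 + x 1 ^ 2 := by
    rw [EuclideanSpace.real_norm_sq_eq, Fin.sum_univ_two]
  have hS := Real.sin_sq_add_cos_sq (u ‖x‖)
  have hx' := hx.ne'
  rw [EuclideanSpace.real_norm_sq_eq, EuclideanSpace.real_norm_sq_eq]
  simp only [Fin.sum_univ_three]
  simp [ansatzPartial]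
  generalize Real.sin (u ‖x‖) = S at *
  generalize Real.cos (u ‖x‖) = C at *
  generalize v ‖x‖ = b at *
  generalize ‖x‖ = R at *
  generalize x 0 = p at *
  generalize x 1 = q at *
  field_simp
  linear_combination R ^ 6 * b ^ 2 * hS - hr * (2 * S * R ^ 2 * (R * b * C - S) +
    (R * b * C - S) ^ 2 * (p ^ 2 + q ^ 2 + R ^ 2) + S ^ 2 * R ^ 4 * b ^ 2)

theorem ansatz_tension {u v : ℝ → ℝ} {c : ℝ} {x : EuclideanSpace ℝ (Fin 2)} (hx : 0 < ‖x‖)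
    (hu : ∀ᶠ r in nhds ‖x‖, HasDerivAt u (v r) r) (hv : HasDerivAt v c ‖x‖) :
    lap2 (ansatz u) x + (‖pderiv2 0 (ansatz u) x‖ ^ 2 + ‖pderiv2 1 (ansatz u) x‖ ^ 2) •
        ansatz u x =
      (c + 1 / ‖x‖ * v ‖x‖ - Real.sin (2 * u ‖x‖) / (2 * ‖x‖ ^ 2)) •
        !₂[x 0 / ‖x‖ * Real.cos (u ‖x‖), x 1 / ‖x‖ * Real.cos (u ‖x‖), -Real.sin (u ‖x‖)] := by
  have hnorm : Filter.Tendsto (fun y : EuclideanSpace ℝ (Fin 2) => ‖y‖) (nhds x) (nhds ‖x‖) :=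
    continuous_norm.tendsto x
  have he (i : Fin 2) : pderiv2 i (ansatz u) =ᶠ[nhds x] ansatzPartial u v i := by
    filter_upwards [hnorm.eventually hu, hnorm.eventually (lt_mem_nhds hx)] with y hy hy0
    exact pderiv2_ansatz hy0 hy i
  have h2 (i : Fin 2) : pderiv2 i (pderiv2 i (ansatz u)) x = pderiv2 i (ansatzPartial u v i) x := by
    rw [pderiv2, (he i).fderiv_eq, pderiv2]
  rw [lap2, h2, h2, pderiv2_ansatzPartial hx hu.self_of_nhds hv,
    pderiv2_ansatzPartial hx hu.self_of_nhds hv, (he 0).self_of_nhds, (he 1).self_of_nhds,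
    norm_ansatzPartial_sq_add hx, Real.sin_two_mul]
  have hr : ‖x‖ ^ 2 = x 0 ^ 2 + x 1 ^ 2 := by
    rw [EuclideanSpace.real_norm_sq_eq, Fin.sum_univ_two]
  have hS := Real.sin_sq_add_cos_sq (u ‖x‖)
  have hx' := hx.ne'
  ext j
  fin_cases j <;> simp [ansatz] <;> generalize Real.sin (u ‖x‖) = S at * <;>
    generalize Real.cos (u ‖x‖) = C at * <;> generalize v ‖x‖ = b at * <;>
    generalize ‖x‖ = R at * <;> generalize x 0 = p at * <;> generalize x 1 = q at * <;>
    field_simp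
  · linear_combination p * R ^ 2 * S * hS -
      p * (R * (R * (C * c - b ^ 2 * S) - b * C * 3) + S * 3) * hr
  · linear_combination q * R ^ 2 * S * hS -
      q * (R * (R * (C * c - b ^ 2 * S) - b * C * 3) + S * 3) * hr
  · linear_combination (S * R * c + b ^ 2 * R * C - S * b) * hr

theorem hasDerivWithinAt_ansatz {u : ℝ → ℝ → ℝ} {s : Set ℝ} {t w : ℝ}
    {x : EuclideanSpace ℝ (Fin 2)} (h : HasDerivWithinAt (fun t => u t ‖x‖) w s t) :
    HasDerivWithinAt (fun t => ansatz (u t) x)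
      (w • !₂[x 0 / ‖x‖ * Real.cos (u t ‖x‖), x 1 / ‖x‖ * Real.cos (u t ‖x‖),
        -Real.sin (u t ‖x‖)]) s t := by
  rw [hasDerivWithinAt_iff_hasFDerivWithinAt, hasFDerivWithinAt_euclidean]
  intro j
  have h0 (a : ℝ) := (h.sin.const_mul a).hasFDerivWithinAt
  fin_cases j
  · refine (h0 (x 0 / ‖x‖)).congr_fderiv ?_
    ext
    simp
    ring
  · refine (h0 (x 1 / ‖x‖)).congr_fderiv ?_
    ext
    simp
    ring
  · refine h.cos.hasFDerivWithinAt.congr_fderiv ?_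
    ext
    simp
    ring

theorem hmhf_iff_radially_symmetric_equation
    (T : ℝ) (hT : 0 < T) (u : ℝ → ℝ → ℝ)
    (ht : ∀ r ∈ Set.Ioo (0:ℝ) 1, ContDiffOn ℝ 1 (fun t => u t r) (Set.Icc 0 T))
    (hr : ∀ t ∈ Set.Icc (0:ℝ) T, ContDiffOn ℝ 2 (u t) (Set.Ioo 0 1)) :
    (∀ t ∈ Set.Icc (0:ℝ) T, ∀ x : EuclideanSpace ℝ (Fin 2), 0 < ‖x‖ → ‖x‖ < 1 →
        derivWithin (fun s => ansatz (u s) x) (Set.Icc 0 T) t =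
          lap2 (ansatz (u t)) x +
            (‖pderiv2 0 (ansatz (u t)) x‖ ^ 2 + ‖pderiv2 1 (ansatz (u t)) x‖ ^ 2) •
              ansatz (u t) x)
    ↔
    (∀ t ∈ Set.Icc (0:ℝ) T, ∀ r ∈ Set.Ioo (0:ℝ) 1,
        derivWithin (fun s => u s r) (Set.Icc 0 T) t =
          deriv (deriv (u t)) r + (1 / r) * deriv (u t) r -
            Real.sin (2 * u t r) / (2 * r ^ 2)) := by
  have hpt (t : ℝ) (hmem : t ∈ Set.Icc (0 : ℝ) T) (x : EuclideanSpace ℝ (Fin 2))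
      (hx : 0 < ‖x‖) (hx1 : ‖x‖ < 1) :
      (derivWithin (fun s => ansatz (u s) x) (Set.Icc 0 T) t =
          lap2 (ansatz (u t)) x +
            (‖pderiv2 0 (ansatz (u t)) x‖ ^ 2 + ‖pderiv2 1 (ansatz (u t)) x‖ ^ 2) •
              ansatz (u t) x) ↔
        derivWithin (fun s => u s ‖x‖) (Set.Icc 0 T) t =
          deriv (deriv (u t)) ‖x‖ + (1 / ‖x‖) * deriv (u t) ‖x‖ -
            Real.sin (2 * u t ‖x‖) / (2 * ‖x‖ ^ 2) := by
    have hrmem : ‖x‖ ∈ Set.Ioo (0 : ℝ) 1 := ⟨hx, hx1⟩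
    have hdiff : DifferentiableOn ℝ (u t) (Set.Ioo 0 1) := (hr t hmem).differentiableOn (by simp)
    have hu : ∀ᶠ r in nhds ‖x‖, HasDerivAt (u t) (deriv (u t) r) r := by
      filter_upwards [isOpen_Ioo.mem_nhds hrmem] with r hr'
      exact (hdiff.differentiableAt (isOpen_Ioo.mem_nhds hr')).hasDerivAt
    have hv : HasDerivAt (deriv (u t)) (deriv (deriv (u t)) ‖x‖) ‖x‖ := by
      have : ContDiffOn ℝ 1 (deriv (u t)) (Set.Ioo 0 1) :=
        (hr t hmem).deriv_of_isOpen isOpen_Ioo (by norm_num)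
      exact ((this.differentiableOn (by simp)).differentiableAt
        (isOpen_Ioo.mem_nhds hrmem)).hasDerivAt
    have hw := (((ht ‖x‖ hrmem).differentiableOn (by simp)) t hmem).hasDerivWithinAt
    rw [ansatz_tension hx hu hv,
      (hasDerivWithinAt_ansatz hw).derivWithin (uniqueDiffOn_Icc hT t hmem)]
    refine (smul_left_injective ℝ fun h0 => ?_).eq_iff
    have hs : Real.sin (u t ‖x‖) = 0 := by simpa using congrArg (fun y => y.ofLp 2) h0
    have hc : Real.cos (u t ‖x‖) ≠ 0 := fun hc => by
      simpa [hs, hc] using Real.sin_sq_add_cos_sq (u t ‖x‖)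
    have hzero : x = 0 := by
      ext j
      fin_cases j
      · simpa [hc, hx.ne'] using congrArg (fun y => y.ofLp 0) h0
      · simpa [hc, hx.ne'] using congrArg (fun y => y.ofLp 1) h0
    simp [hzero] at hx
  constructor
  · intro h t hmem r hrmem
    have hn : ‖(EuclideanSpace.single 0 r : EuclideanSpace ℝ (Fin 2))‖ = r := by
      rw [PiLp.norm_single, Real.norm_of_nonneg hrmem.1.le]
    have hx : 0 < ‖(EuclideanSpace.single 0 r : EuclideanSpace ℝ (Fin 2))‖ := hn.symm ▸ hrmem.1
    have hx1 : ‖(EuclideanSpace.single 0 r : EuclideanSpace ℝ (Fin 2))‖ < 1 := hn.symm ▸ hrmem.2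
    simpa only [hn] using (hpt t hmem _ hx hx1).1 (h t hmem _ hx hx1)
  · intro h t hmem x hx hx1
    exact (hpt t hmem x hx hx1).2 (h t hmem _ ⟨hx, hx1⟩)

end
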